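/- Let k be an algebraically closed field with char k ≠ 2, and consider k⁷ with the standard trilinear form γ₀ = f*₁₄₇ + f*₂₄₆ + f*₃₄₅ − f*₁₅₆ − f*₂₃₇. For z₁, z₂ ∈ k× let g_{z₁,z₂} be the diagonal automorphism of k⁷ with entries (z₁, z₂, z₁z₂⁻¹, 1, z₁⁻¹z₂, z₂⁻¹, z₁⁻¹) in the basis f₁,…,f₇. Let (F₁, F₂) be a pair of subspaces of k⁷ with F₁ ⊆ F₂, dim F₁ = 1, dim F₂ = 2, and F₂ γ₀-isotropic. Then g_{z₁,z₂}(F₁) = F₁ and g_{z₁,z₂}(F₂) = F₂ for all z₁, z₂ ∈ k× if and only if (F₁, F₂) = (span{f_i}, span{f_i, f_j}) for one of the 12 pairs (i, j) ∈ {(1,2), (1,3), (2,1), (2,5), (3,1), (3,6), (5,2), (5,7), (6,3), (6,7), (7,5), (7,6)}. -/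

import Mathlib

open Module

/-- The alternating trilinear form `f*ₚqᵣ` on `k⁷`. -/
def tripleDet {k : Type*} [Field k] (p q r : Fin 7) (u v w : Fin 7 → k) : k :=
  Matrix.det !![u p, u q, u r; v p, v q, v r; w p, w q, w r]

/-- The standard trilinear form `γ₀ = f*₁₄₇ + f*₂₄₆ + f*₃₄₅ − f*₁₅₆ − f*₂₃₇` on `k⁷`. -/
def gammaStd {k : Type*} [Field k] (u v w : Fin 7 → k) : k :=
  tripleDet 0 3 6 u v w + tripleDet 1 3 5 u v w + tripleDet 2 3 4 u v w
    - tripleDet 0 4 5 u v w - tripleDet 1 2 6 u v w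

/-- The diagonal torus element `g_{z₁,z₂} = diag(z₁, z₂, z₁z₂⁻¹, 1, z₁⁻¹z₂, z₂⁻¹, z₁⁻¹)`. -/
def torusAct {k : Type*} [Field k] (z₁ z₂ : k) (u : Fin 7 → k) : Fin 7 → k :=
  fun i => ![z₁, z₂, z₁ * z₂⁻¹, 1, z₁⁻¹ * z₂, z₂⁻¹, z₁⁻¹] i * u i

open Polynomial in
/-- A subspace of `ι → k` stable under a diagonal operator with pairwise distinct entries contains
every coordinate vector that occurs in the support of one of its elements. -/
lemma single_mem_of_diagonal_stable {k ι : Type*} [Field k] [Fintype ι] [DecidableEq ι]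
    {w : ι → k} (hw : Function.Injective w) {F : Submodule k (ι → k)}
    (hF : ∀ u ∈ F, w * u ∈ F) {u : ι → k} (hu : u ∈ F) {i : ι} (hi : u i ≠ 0) :
    Pi.single i (1 : k) ∈ F := by
  have hpoly : ∀ p : k[X], (fun j => p.eval (w j) * u j) ∈ F := by
    intro p
    induction p using Polynomial.induction_on with
    | C a => simpa [Pi.smul_def] using F.smul_mem a hu
    | add p q hp hq =>
      convert F.add_mem hp hq using 1
      ext j
      simp [add_mul]
    | monomial n a h =>
      convert hF _ h using 1
      ext j
      simp [pow_succ]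
      ring
  have h := F.smul_mem (u i)⁻¹ (hpoly (Lagrange.basis Finset.univ w i))
  convert h using 1
  ext j
  by_cases hj : j = i
  · subst hj
    simp [Lagrange.eval_basis_self hw.injOn (Finset.mem_univ j), hi]
  · simp [hj, Lagrange.eval_basis_of_ne (Ne.symm hj) (Finset.mem_univ j)]

/-- A flag of dimensions `(1, 2)` stable under a diagonal operator with pairwise distinct entries
is a coordinate flag. -/
lemma exists_eq_span_single_of_diagonal_stable {k ι : Type*} [Field k] [Fintype ι] [DecidableEq ι]
    {w : ι → k} (hw : Function.Injective w) {F₁ F₂ : Submodule k (ι → k)} (hle : F₁ ≤ F₂)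
    (hd₁ : finrank k F₁ = 1) (hd₂ : finrank k F₂ = 2)
    (hstab₁ : ∀ u ∈ F₁, w * u ∈ F₁) (hstab₂ : ∀ u ∈ F₂, w * u ∈ F₂) :
    ∃ i j : ι, i ≠ j ∧ F₁ = Submodule.span k {Pi.single i (1 : k)} ∧
      F₂ = Submodule.span k {Pi.single i (1 : k), Pi.single j (1 : k)} := by
  have hne : F₁ ≠ ⊥ := by
    rintro rfl
    simp at hd₁
  obtain ⟨u, hu, hu0⟩ := F₁.ne_bot_iff.1 hne
  obtain ⟨i, hi⟩ := Function.ne_iff.1 hu0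
  have hmem_i : Pi.single i (1 : k) ∈ F₁ := single_mem_of_diagonal_stable hw hstab₁ hu hi
  have hspan₁ : Submodule.span k {Pi.single i (1 : k)} = F₁ := by
    refine Submodule.eq_of_le_of_finrank_eq (by simpa using hmem_i) ?_
    rw [hd₁, finrank_span_singleton (by simp)]
  obtain ⟨v, hv, hv₁⟩ : ∃ v ∈ F₂, v ∉ F₁ := by
    by_contra! h
    have := Submodule.finrank_mono (show F₂ ≤ F₁ from h)
    omega
  obtain ⟨j, hji, hj⟩ : ∃ j, j ≠ i ∧ v j ≠ 0 := by
    by_contra! h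
    refine hv₁ ?_
    have hv_eq : v = v i • Pi.single i (1 : k) := by
      ext j
      by_cases hj : j = i
      · subst hj
        simp
      · simp [hj, h j hj]
    rw [hv_eq]
    exact F₁.smul_mem _ hmem_i
  have hmem_j : Pi.single j (1 : k) ∈ F₂ := single_mem_of_diagonal_stable hw hstab₂ hv hj
  have hlt : F₁ < Submodule.span k {Pi.single i (1 : k), Pi.single j (1 : k)} := by
    rw [← hspan₁]
    refine lt_of_le_of_ne (Submodule.span_mono (by simp)) fun h => ?_
    have hj_mem : (Pi.single j (1 : k) : ι → k) ∈
        Submodule.span k {(Pi.single i (1 : k) : ι → k)} := by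
      rw [h]
      exact Submodule.subset_span (by simp)
    obtain ⟨c, hc⟩ := Submodule.mem_span_singleton.1 hj_mem
    simpa [hji] using congrFun hc j
  have hspan₂ : Submodule.span k {Pi.single i (1 : k), Pi.single j (1 : k)} = F₂ := by
    have hle₂ : Submodule.span k {Pi.single i (1 : k), Pi.single j (1 : k)} ≤ F₂ := by
      rw [Submodule.span_le, Set.pair_subset_iff]
      exact ⟨hle hmem_i, hmem_j⟩
    refine Submodule.eq_of_le_of_finrank_le hle₂ ?_
    have := Submodule.finrank_lt_finrank_of_lt hlt
    omega
  exact ⟨i, j, hji.symm, hspan₁.symm, hspan₂.symm⟩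

/-- The entries of the diagonal matrix `g_{z₁,z₂}`. -/
def torusWeight {k : Type*} [Field k] (z₁ z₂ : k) : Fin 7 → k :=
  ![z₁, z₂, z₁ * z₂⁻¹, 1, z₁⁻¹ * z₂, z₂⁻¹, z₁⁻¹]

lemma torusAct_eq_mul {k : Type*} [Field k] (z₁ z₂ : k) (u : Fin 7 → k) :
    torusAct z₁ z₂ u = torusWeight z₁ z₂ * u := rfl

lemma exists_injective_torusWeight (k : Type*) [Field k] [Infinite k] :
    ∃ z₁ z₂ : k, z₁ ≠ 0 ∧ z₂ ≠ 0 ∧ Function.Injective (torusWeight z₁ z₂) := by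
  obtain ⟨t, ht⟩ : ∃ t : k, t ^ 61 - t ≠ 0 := by
    by_contra! h
    refine FiniteField.X_pow_card_sub_X_ne_zero k (p := 61) (by norm_num) ?_
    exact Polynomial.funext fun t => by simpa using h t
  have ht0 : t ≠ 0 := by
    rintro rfl
    simp at ht
  have hpow : ∀ n : ℤ, n ∣ 60 → t ^ n ≠ 1 := by
    rintro n ⟨m, hm⟩ h
    apply ht
    have h60 : t ^ (60 : ℤ) = 1 := by rw [hm, zpow_mul, h, one_zpow]
    have h60' : t ^ 60 = 1 := mod_cast h60
    rw [pow_succ, h60', one_mul, sub_self]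
  have hweight : torusWeight (t ^ 3) t = fun i => t ^ (![3, 1, 2, 0, -2, -1, -3] i : ℤ) := by
    ext i
    fin_cases i <;> simp [torusWeight, zpow_neg] <;> field_simp
  refine ⟨t ^ 3, t, pow_ne_zero 3 ht0, ht0, ?_⟩
  rw [hweight]
  intro i j hij
  by_contra hne
  have hdvd : ∀ i j : Fin 7, i ≠ j →
      (![3, 1, 2, 0, -2, -1, -3] i - ![3, 1, 2, 0, -2, -1, -3] j : ℤ) ∣ 60 := by
    decide
  refine hpow _ (hdvd i j hne) ?_
  rw [zpow_sub₀ ht0]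
  exact (div_eq_one_iff_eq (zpow_ne_zero _ ht0)).2 hij

/-- The index pairs of isotropic coordinate flags are those `(i, j)` with `i ≠ j` and
`γ₀(fᵢ, fⱼ, ·) = 0`. -/
lemma mem_of_gammaStd_single_eq_zero {k : Type*} [Field k] {i j : Fin 7} (hij : i ≠ j)
    (h : ∀ x : Fin 7 → k, gammaStd (Pi.single i 1) (Pi.single j 1) x = 0) :
    (i, j) ∈ ([(0, 1), (0, 2), (1, 0), (1, 4), (2, 0), (2, 5), (4, 1), (4, 6),
      (5, 2), (5, 6), (6, 4), (6, 5)] : List (Fin 7 × Fin 7)) := by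
  -- Any two indices occur together in at most one term of `γ₀`, so no cancellation can occur.
  have h1 := h 1
  revert hij h1
  clear h
  fin_cases i <;> fin_cases j <;>
    simp [gammaStd, tripleDet, Matrix.det_fin_three]

lemma mul_mem_span_single {k ι : Type*} [Field k] [DecidableEq ι] (s : Set ι) (w : ι → k)
    {u : ι → k} (hu : u ∈ Submodule.span k ((fun i => Pi.single i (1 : k)) '' s)) :
    w * u ∈ Submodule.span k ((fun i => Pi.single i (1 : k)) '' s) := by
  refine (Submodule.map_span_le (LinearMap.mulLeft k w) _ _).2 ?_ (Submodule.mem_map_of_mem hu)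
  rintro _ ⟨i, hi, rfl⟩
  have h : w * Pi.single i (1 : k) = w i • Pi.single i (1 : k) := by
    ext j
    by_cases hj : j = i
    · subst hj
      simp
    · simp [hj]
  rw [LinearMap.mulLeft_apply, h]
  exact Submodule.smul_mem _ _ (Submodule.subset_span ⟨i, hi, rfl⟩)

lemma torusAct_image_span_single {k : Type*} [Field k] (s : Set (Fin 7)) {z₁ z₂ : k}
    (h₁ : z₁ ≠ 0) (h₂ : z₂ ≠ 0) :
    torusAct z₁ z₂ '' (Submodule.span k ((fun i => Pi.single i (1 : k)) '' s) : Set (Fin 7 → k)) =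
      Submodule.span k ((fun i => Pi.single i (1 : k)) '' s) := by
  apply Set.Subset.antisymm
  · rintro _ ⟨u, hu, rfl⟩
    exact mul_mem_span_single s (torusWeight z₁ z₂) hu
  · intro u hu
    refine ⟨(torusWeight z₁ z₂)⁻¹ * u, mul_mem_span_single s _ hu, ?_⟩
    rw [torusAct_eq_mul]
    ext i
    refine mul_inv_cancel_left₀ (?_ : torusWeight z₁ z₂ i ≠ 0) (u i)
    fin_cases i <;> simp [torusWeight, h₁, h₂]

/-- A `γ₀`-isotropic flag `(F₁, F₂)` in `k⁷` is invariant under the whole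
torus iff it is one of the `12` coordinate flags `e(i j)` (here with `0`-based indices). -/
theorem torus_fixed_flags
    {k : Type*} [Field k] [IsAlgClosed k] (hchar : (2 : k) ≠ 0)
    (F₁ F₂ : Submodule k (Fin 7 → k)) (hle : F₁ ≤ F₂)
    (hd₁ : finrank k F₁ = 1) (hd₂ : finrank k F₂ = 2)
    (hiso : ∀ u ∈ F₂, ∀ v ∈ F₂, ∀ x : Fin 7 → k, gammaStd u v x = 0) :
    (∀ z₁ z₂ : k, z₁ ≠ 0 → z₂ ≠ 0 →
        torusAct z₁ z₂ '' (F₁ : Set (Fin 7 → k)) = (F₁ : Set (Fin 7 → k)) ∧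
        torusAct z₁ z₂ '' (F₂ : Set (Fin 7 → k)) = (F₂ : Set (Fin 7 → k))) ↔
      ∃ p ∈ ([(0, 1), (0, 2), (1, 0), (1, 4), (2, 0), (2, 5), (4, 1), (4, 6),
          (5, 2), (5, 6), (6, 4), (6, 5)] : List (Fin 7 × Fin 7)),
        F₁ = Submodule.span k {Pi.single p.1 (1 : k)} ∧
        F₂ = Submodule.span k {Pi.single p.1 (1 : k), Pi.single p.2 (1 : k)} := by
  constructor
  · intro hinv
    have : Infinite k := IsAlgClosed.instInfinite
    obtain ⟨z₁, z₂, h₁, h₂, hw⟩ := exists_injective_torusWeight k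
    obtain ⟨hF₁, hF₂⟩ := hinv z₁ z₂ h₁ h₂
    have hstab₁ : ∀ u ∈ F₁, torusWeight z₁ z₂ * u ∈ F₁ := fun u hu =>
      hF₁.subset (Set.mem_image_of_mem _ hu)
    have hstab₂ : ∀ u ∈ F₂, torusWeight z₁ z₂ * u ∈ F₂ := fun u hu =>
      hF₂.subset (Set.mem_image_of_mem _ hu)
    obtain ⟨i, j, hij, hspan₁, hspan₂⟩ :=
      exists_eq_span_single_of_diagonal_stable hw hle hd₁ hd₂ hstab₁ hstab₂
    have hmem_i : Pi.single i (1 : k) ∈ F₂ := hspan₂ ▸ Submodule.subset_span (by simp)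
    have hmem_j : Pi.single j (1 : k) ∈ F₂ := hspan₂ ▸ Submodule.subset_span (by simp)
    exact ⟨(i, j), mem_of_gammaStd_single_eq_zero hij (hiso _ hmem_i _ hmem_j), hspan₁, hspan₂⟩
  · rintro ⟨⟨i, j⟩, -, rfl, rfl⟩ z₁ z₂ h₁ h₂
    have hi := torusAct_image_span_single {i} h₁ h₂
    have hij := torusAct_image_span_single {i, j} h₁ h₂
    rw [Set.image_singleton] at hi
    rw [Set.image_pair] at hij
    exact ⟨hi, hij⟩
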